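/- arXiv:1610.05915 — 6 statements merged into one kernel-verified Lean document; each statement's English description precedes it below -/
import Mathlib

section
/- Let X be a real Banach space, φ₁ : X × X × [0,1] → X and φ₂ : X × X × [0,1] × (X → ℝ) → ℝ. Assume (P₁): φ₁(x, x, 0) = x for all x ∈ X, and assume that h : X → ℝ is a (φ₁,φ₂)-convex function satisfying (P₃) for a constant C ≥ 1: φ₂(λx, λx, 0, h) ≤ C((1 − λ)h(0) + λh(x)) for all x ∈ X and λ ∈ [0,1]. Then for every x ∈ X, every λ > 1 and y = λx, one has h(y) − h(0) ≥ (λ/C)(h(x) − C·h(0)). -/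
open Filter Set

/-- A function `f : X → ℝ` is `(φ₁, φ₂)`-convex if
`f (φ₁ x y λ) ≤ φ₂ x y λ f` for all `x, y ∈ X` and `λ ∈ [0,1]`. -/
def PhiConvex {X : Type*} [NormedAddCommGroup X] [NormedSpace ℝ X]
    (φ₁ : X → X → ℝ → X) (φ₂ : X → X → ℝ → (X → ℝ) → ℝ) (f : X → ℝ) : Prop :=
  ∀ x y : X, ∀ t ∈ Set.Icc (0 : ℝ) 1, f (φ₁ x y t) ≤ φ₂ x y t f

/-- Lemma 2.2: under (P₁) and (P₃), for `y = λ x` with `λ > 1` one has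
`h(y) - h(0) ≥ (λ/C)(h(x) - C h(0))`. -/
theorem lemma_2_2
    {X : Type*} [NormedAddCommGroup X] [NormedSpace ℝ X] [CompleteSpace X]
    (φ₁ : X → X → ℝ → X) (φ₂ : X → X → ℝ → (X → ℝ) → ℝ)
    (hP1 : ∀ x : X, φ₁ x x 0 = x)
    (C : ℝ) (hC : 1 ≤ C)
    (h : X → ℝ) (hconv : PhiConvex φ₁ φ₂ h)
    (hP3 : ∀ x : X, ∀ t ∈ Set.Icc (0 : ℝ) 1,
      φ₂ (t • x) (t • x) 0 h ≤ C * ((1 - t) * h 0 + t * h x)) :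
    ∀ (x : X) (lam : ℝ), 1 < lam →
      h (lam • x) - h 0 ≥ (lam / C) * (h x - C * h 0) := by
  intro x lam hlam
  have hl : 0 < lam := by linarith
  have hC0 : 0 < C := by linarith
  have ht : lam⁻¹ ∈ Set.Icc (0 : ℝ) 1 := ⟨by positivity, inv_le_one_of_one_le₀ hlam.le⟩
  have hconv' := hconv x x 0 ⟨le_rfl, zero_le_one⟩
  have hscale := hP3 (lam • x) lam⁻¹ ht
  rw [inv_smul_smul₀ hl.ne'] at hscale
  rw [hP1] at hconv'
  have hmul := mul_le_mul_of_nonneg_left (hconv'.trans hscale) (div_pos hl hC0).le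
  have hleft : lam / C * (C * ((1 - lam⁻¹) * h 0 + lam⁻¹ * h (lam • x))) =
      (lam - 1) * h 0 + h (lam • x) := by
    field_simp
  have hright : lam / C * (h x - C * h 0) = lam / C * h x - lam * h 0 := by
    field_simp
  linarith
end

section
/- Let X be a real Banach space, φ₁ : X × X × [0,1] → X and φ₂ : X × X × [0,1] × (X → ℝ) → ℝ. Assume (P₁): φ₁(x, x, 0) = x for all x ∈ X, and (P₃): there is C ≥ 1 such that φ₂(λx, λx, 0, h) ≤ C((1 − λ)h(0) + λh(x)) for all x ∈ X, λ ∈ [0,1] and all h ∈ Φ. Then the set F = {f ∈ Φ : f(x) → +∞ as ‖x‖ → +∞} is open in the metric space (Φ, ρ), where ρ(f,g) = μ(f − g). -/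
open Filter Set ENNReal

/-- `‖f‖_r = sup {|f x| : ‖x‖ ≤ r}`, valued in `ℝ≥0∞`. -/
noncomputable def ballSup {X : Type*} [NormedAddCommGroup X] (f : X → ℝ) (r : ℝ) : ℝ≥0∞ :=
  ⨆ x ∈ {x : X | ‖x‖ ≤ r}, (‖f x‖₊ : ℝ≥0∞)

/-- `μ(f) = Σ_{n ≥ 1} ‖f‖ₙ / 2ⁿ`, valued in `ℝ≥0∞`. -/
noncomputable def mu {X : Type*} [NormedAddCommGroup X] (f : X → ℝ) : ℝ≥0∞ :=
  ∑' n : ℕ, ballSup f (n + 1) / 2 ^ (n + 1)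

lemma abs_lt_of_mu_lt {X : Type*} [NormedAddCommGroup X] {f : X → ℝ} {n : ℕ} {δ : ℝ}
    (h : mu f < ENNReal.ofReal (δ / 2 ^ (n + 1))) {x : X} (hx : ‖x‖ ≤ n + 1) : |f x| < δ := by
  have hle : (‖f x‖₊ : ℝ≥0∞) / 2 ^ (n + 1) ≤ mu f :=
    (ENNReal.div_le_div_right
      (le_iSup₂ (f := fun (x : X) (_ : x ∈ {x : X | ‖x‖ ≤ (n : ℝ) + 1}) => (‖f x‖₊ : ℝ≥0∞)) x hx)
      _).trans (ENNReal.le_tsum (f := fun n : ℕ => ballSup f (n + 1) / 2 ^ (n + 1)) n)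
  have heq : (‖f x‖₊ : ℝ≥0∞) / 2 ^ (n + 1) = ENNReal.ofReal (|f x| / 2 ^ (n + 1)) := by
    rw [ENNReal.ofReal_div_of_pos (by positivity), ENNReal.ofReal_pow (by norm_num),
      ← Real.norm_eq_abs, ofReal_norm, enorm_eq_nnnorm]
    norm_num
  have hlt := lt_of_le_of_lt (heq ▸ hle) h
  rw [ENNReal.ofReal_lt_ofReal_iff_of_nonneg (by positivity)] at hlt
  exact (div_lt_div_iff_of_pos_right (by positivity)).1 hlt

/-- A function that is convex along rays from the origin up to a constant factor and is large on a
sphere, compared with its value at the origin, grows at least linearly. -/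
lemma tendsto_atTop_of_large_on_sphere {X : Type*} [NormedAddCommGroup X] [NormedSpace ℝ X]
    {g : X → ℝ} {C A r : ℝ} (hC : 1 ≤ C) (hr : 0 < r) (h0 : 0 ≤ g 0) (hA : g 0 ≤ A)
    (hg : ∀ x : X, ∀ t ∈ Set.Icc (0 : ℝ) 1, g (t • x) ≤ C * ((1 - t) * g 0 + t * g x))
    (hsphere : ∀ y : X, ‖y‖ = r → C * (A + 1) ≤ g y) :
    Tendsto g (comap (fun x : X => ‖x‖) atTop) atTop := by
  have hnorm : Tendsto (fun x : X => ‖x‖ / r) (comap (fun x : X => ‖x‖) atTop) atTop :=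
    tendsto_comap.atTop_div_const hr
  refine tendsto_atTop_mono' _ ?_ hnorm
  filter_upwards [tendsto_comap.eventually (eventually_ge_atTop r)] with x hx
  have hxpos : 0 < ‖x‖ := hr.trans_le hx
  have ht0 : 0 ≤ r / ‖x‖ := by positivity
  have hgx := hg x (r / ‖x‖) ⟨ht0, (div_le_one hxpos).2 hx⟩
  have hs := hsphere ((r / ‖x‖) • x) (by
    rw [norm_smul, Real.norm_of_nonneg ht0, div_mul_cancel₀ _ hxpos.ne'])
  have hmul := le_of_mul_le_mul_left (hs.trans hgx) (by linarith)
  have hone : 1 ≤ r / ‖x‖ * g x := by nlinarith [mul_nonneg ht0 h0]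
  rw [div_mul_eq_mul_div, le_div_iff₀ hxpos] at hone
  rw [div_le_iff₀ hr]
  linarith

/-- Lemma 2.3: under (P₁) and (P₃), the set `F = {f ∈ Φ : f(x) → +∞ as ‖x‖ → +∞}` is
open in the metric space `(Φ, ρ)` where `ρ(f,g) = μ(f-g)`. -/
theorem F_isOpen_in_Phi
    {X : Type*} [NormedAddCommGroup X] [NormedSpace ℝ X] [CompleteSpace X]
    (φ₁ : X → X → ℝ → X) (φ₂ : X → X → ℝ → (X → ℝ) → ℝ)
    (Phi Fs : Set (X → ℝ))
    (hPhi : Phi = {f : X → ℝ | Continuous f ∧ mu f < ⊤ ∧ PhiConvex φ₁ φ₂ f ∧ ∀ x, 0 ≤ f x})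
    (hFs : Fs = {f ∈ Phi | Tendsto f (comap (fun x : X => ‖x‖) atTop) atTop})
    (hP1 : ∀ x : X, φ₁ x x 0 = x)
    (hP3 : ∃ C : ℝ, 1 ≤ C ∧ ∀ h ∈ Phi, ∀ x : X, ∀ t ∈ Set.Icc (0 : ℝ) 1,
      φ₂ (t • x) (t • x) 0 h ≤ C * ((1 - t) * h 0 + t * h x)) :
    ∀ f ∈ Fs, ∃ ε : ℝ, 0 < ε ∧ ∀ g ∈ Phi, mu (f - g) < ENNReal.ofReal ε → g ∈ Fs := by
  subst hFs
  rintro f ⟨_, hf⟩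
  obtain ⟨C, hC, hP3⟩ := hP3
  obtain ⟨R, hR⟩ := eventually_atTop.1 (eventually_comap.1
    (hf.eventually (eventually_ge_atTop (C * (f 0 + 1 + 1) + 1))))
  obtain ⟨n, hn⟩ := exists_nat_ge R
  refine ⟨1 / 2 ^ (n + 1), by positivity, fun g hg hmu => ⟨hg, ?_⟩⟩
  have hclose : ∀ x : X, ‖x‖ ≤ n + 1 → |f x - g x| < 1 := fun x hx => abs_lt_of_mu_lt hmu hx
  have hg' := hg
  rw [hPhi] at hg'
  obtain ⟨_, _, hconv, hnonneg⟩ := hg'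
  have hzero := abs_lt.1 (hclose 0 (by rw [norm_zero]; positivity))
  refine tendsto_atTop_of_large_on_sphere (A := f 0 + 1) (r := n + 1) hC (by positivity)
    (hnonneg 0) (by linarith) (fun x t ht => ?_) (fun y hy => ?_)
  · have h := hconv (t • x) (t • x) 0 ⟨le_rfl, zero_le_one⟩
    rw [hP1] at h
    exact h.trans (hP3 g hg x t ht)
  · have h := abs_lt.1 (hclose y hy.le)
    have hfy := hR (n + 1) (by linarith) y hy
    linarith
end

section
/- Let X be a real Banach space, φ₁ : X × X × [0,1] → X and φ₂ : X × X × [0,1] × (X → ℝ) → ℝ. Suppose that for all x, y ∈ X and λ ∈ [0,1] the map f ↦ φ₂(x, y, λ, f) is continuous with respect to uniform convergence on bounded subsets of X (i.e. if μ(f_j − f) → 0 then φ₂(x,y,λ,f_j) → φ₂(x,y,λ,f)). Then Φ is a closed subset of the Banach space (M, μ), and hence (Φ, ρ) with ρ(f,g) = μ(f − g) is a complete metric space. -/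
open Filter Set ENNReal

section

variable {X : Type*} [NormedAddCommGroup X]

theorem enorm_le_ballSup (f : X → ℝ) {r : ℝ} {x : X} (hx : ‖x‖ ≤ r) :
    (‖f x‖₊ : ℝ≥0∞) ≤ ballSup f r :=
  le_iSup₂ (f := fun (x : X) (_ : x ∈ {x : X | ‖x‖ ≤ r}) => (‖f x‖₊ : ℝ≥0∞)) x hx

theorem ballSup_add_le (f g : X → ℝ) (r : ℝ) : ballSup (f + g) r ≤ ballSup f r + ballSup g r := by
  refine iSup₂_le fun x hx => ?_
  calc (‖(f + g) x‖₊ : ℝ≥0∞) ≤ ‖f x‖₊ + ‖g x‖₊ := by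
        exact_mod_cast nnnorm_add_le (f x) (g x)
    _ ≤ _ := add_le_add (enorm_le_ballSup f hx) (enorm_le_ballSup g hx)

theorem mu_add_le (f g : X → ℝ) : mu (f + g) ≤ mu f + mu g := by
  unfold mu
  rw [← ENNReal.tsum_add]
  refine ENNReal.tsum_le_tsum fun n => ?_
  rw [← ENNReal.add_div]
  exact ENNReal.div_le_div_right (ballSup_add_le f g _) _

theorem mu_sub_comm (f g : X → ℝ) : mu (f - g) = mu (g - f) := by
  rw [← neg_sub g f]
  simp only [mu, ballSup, Pi.neg_apply, nnnorm_neg]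

theorem enorm_le_mul_mu (f : X → ℝ) (n : ℕ) {x : X} (hx : ‖x‖ ≤ n + 1) :
    (‖f x‖₊ : ℝ≥0∞) ≤ mu f * 2 ^ (n + 1) := by
  refine (enorm_le_ballSup f hx).trans ?_
  rw [← ENNReal.div_le_iff (by positivity) (by finiteness)]
  exact ENNReal.le_tsum (f := fun n : ℕ => ballSup f (n + 1) / 2 ^ (n + 1)) n

/-- `mu` is lower semicontinuous for pointwise convergence. -/
theorem lowerSemicontinuous_mu : LowerSemicontinuous (mu : (X → ℝ) → ℝ≥0∞) := by
  unfold mu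
  refine lowerSemicontinuous_tsum fun n => ?_
  simp only [ballSup, ENNReal.iSup_div]
  refine lowerSemicontinuous_biSup fun x _ => Continuous.lowerSemicontinuous ?_
  refine (ENNReal.continuous_div_const _ (by positivity)).comp ?_
  exact ENNReal.continuous_coe.comp (continuous_apply x).nnnorm

theorem tendstoUniformlyOn_of_mu {F : ℕ → X → ℝ} {f : X → ℝ}
    (h : Tendsto (fun j => mu (F j - f)) atTop (nhds 0)) (n : ℕ) :
    TendstoUniformlyOn F f atTop {x | ‖x‖ ≤ n + 1} := by
  rw [EMetric.tendstoUniformlyOn_iff]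
  intro ε hε
  have h' : Tendsto (fun j => mu (F j - f) * 2 ^ (n + 1)) atTop (nhds 0) := by
    simpa using ENNReal.Tendsto.mul_const h (Or.inr (by finiteness : (2 : ℝ≥0∞) ^ (n + 1) ≠ ⊤))
  filter_upwards [h'.eventually_lt_const hε] with j hj x hx
  rw [edist_comm, edist_eq_enorm_sub]
  exact (enorm_le_mul_mu (F j - f) n hx).trans_lt hj

theorem tendstoLocallyUniformly_of_mu {F : ℕ → X → ℝ} {f : X → ℝ}
    (h : Tendsto (fun j => mu (F j - f)) atTop (nhds 0)) :
    TendstoLocallyUniformly F f atTop := by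
  refine tendstoLocallyUniformly_of_forall_exists_nhds fun x => ?_
  obtain ⟨n, hn⟩ := exists_nat_gt ‖x‖
  refine ⟨_, ?_, tendstoUniformlyOn_of_mu h n⟩
  filter_upwards [continuous_norm.continuousAt.eventually_lt_const hn] with y hy
  exact hy.le.trans (by simp)

theorem tendsto_apply_of_mu {F : ℕ → X → ℝ} {f : X → ℝ}
    (h : Tendsto (fun j => mu (F j - f)) atTop (nhds 0)) (x : X) :
    Tendsto (fun j => F j x) atTop (nhds (f x)) :=
  (tendstoLocallyUniformlyOn_univ.2 (tendstoLocallyUniformly_of_mu h)).tendsto_at (mem_univ x)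

/-- A `mu`-Cauchy sequence has a `mu`-limit. -/
theorem exists_tendsto_mu_of_cauchy {F : ℕ → X → ℝ}
    (hF : ∀ ε : ℝ, 0 < ε → ∃ N : ℕ, ∀ m ≥ N, ∀ n ≥ N, mu (F m - F n) < ENNReal.ofReal ε) :
    ∃ g : X → ℝ, Tendsto (fun j => mu (F j - g)) atTop (nhds 0) := by
  have hpt : ∀ x, ∃ a, Tendsto (fun j => F j x) atTop (nhds a) := by
    intro x
    refine cauchySeq_tendsto_of_complete (Metric.cauchySeq_iff.2 fun ε hε => ?_)
    obtain ⟨k, hk⟩ := exists_nat_ge ‖x‖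
    obtain ⟨N, hN⟩ := hF (ε / 2 ^ (k + 1)) (by positivity)
    refine ⟨N, fun m hm n hn => ?_⟩
    have h1 := enorm_le_mul_mu (F m - F n) k (x := x) (hk.trans (by simp))
    have h2 : mu (F m - F n) * 2 ^ (k + 1) < ENNReal.ofReal ε := by
      rw [← ENNReal.lt_div_iff_mul_lt (Or.inl (by positivity)) (Or.inl (by finiteness))]
      have h3 := hN m hm n hn
      rwa [ENNReal.ofReal_div_of_pos (by positivity), ENNReal.ofReal_pow (by norm_num),
        ENNReal.ofReal_ofNat] at h3
    have h4 := h1.trans_lt h2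
    rw [← edist_lt_ofReal, edist_eq_enorm_sub]
    exact h4
  choose g hg using hpt
  refine ⟨g, ENNReal.tendsto_nhds_zero.2 fun ε hε => ?_⟩
  obtain ⟨δ, hδ0, hδ⟩ : ∃ δ : ℝ, 0 < δ ∧ ENNReal.ofReal δ ≤ ε := by
    obtain ⟨δ, hδ0, hδ⟩ := ENNReal.lt_iff_exists_nnreal_btwn.1 hε
    exact ⟨δ, by exact_mod_cast hδ0, by simpa using hδ.le⟩
  obtain ⟨N, hN⟩ := hF δ hδ0
  filter_upwards [eventually_ge_atTop N] with j hj
  have hlim : Tendsto (fun m => F j - F m) atTop (nhds (F j - g)) :=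
    tendsto_const_nhds.sub (tendsto_pi_nhds.2 hg)
  by_contra! hlt
  obtain ⟨m, hm, hmN⟩ := ((hlim.eventually (lowerSemicontinuous_mu (F j - g) ε hlt)).and
    (eventually_ge_atTop N)).exists
  exact (hm.trans ((hN j hj m hmN).trans_le hδ)).false

end

/-- The nonnegative `(φ₁, φ₂)`-convex elements of `M` are stable under `mu`-limits. -/
theorem phiConvex_of_tendsto_mu {X : Type*} [NormedAddCommGroup X] [NormedSpace ℝ X]
    {φ₁ : X → X → ℝ → X} {φ₂ : X → X → ℝ → (X → ℝ) → ℝ} {F : ℕ → X → ℝ} {f : X → ℝ}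
    (hφ : ∀ x y : X, ∀ t ∈ Set.Icc (0 : ℝ) 1,
      Tendsto (fun j => φ₂ x y t (F j)) atTop (nhds (φ₂ x y t f)))
    (hF : ∀ j, PhiConvex φ₁ φ₂ (F j))
    (h : Tendsto (fun j => mu (F j - f)) atTop (nhds 0)) : PhiConvex φ₁ φ₂ f :=
  fun x y t ht => le_of_tendsto_of_tendsto' (tendsto_apply_of_mu h _) (hφ x y t ht)
    fun j => hF j x y t ht

theorem mu_lt_top_of_tendsto_mu {X : Type*} [NormedAddCommGroup X] {F : ℕ → X → ℝ} {f : X → ℝ}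
    (hF : ∀ j, mu (F j) < ⊤) (h : Tendsto (fun j => mu (F j - f)) atTop (nhds 0)) :
    mu f < ⊤ := by
  obtain ⟨j, hj⟩ := (h.eventually_lt_const ENNReal.zero_lt_top).exists
  calc mu f = mu ((f - F j) + F j) := by rw [sub_add_cancel]
    _ ≤ mu (f - F j) + mu (F j) := mu_add_le _ _
    _ < ⊤ := ENNReal.add_lt_top.2 ⟨mu_sub_comm f (F j) ▸ hj, hF j⟩

/-- If `f ↦ φ₂ x y λ f` is continuous with respect to `μ`-convergence (uniform convergence
on bounded sets), then `Φ` is closed in the Banach space `(M, μ)`, and hence `(Φ, ρ)` with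
`ρ(f,g) = μ(f-g)` is a complete metric space. -/
theorem Phi_closed_and_complete
    {X : Type*} [NormedAddCommGroup X] [NormedSpace ℝ X] [CompleteSpace X]
    (φ₁ : X → X → ℝ → X) (φ₂ : X → X → ℝ → (X → ℝ) → ℝ)
    (Phi : Set (X → ℝ))
    (hPhi : Phi = {f : X → ℝ | Continuous f ∧ mu f < ⊤ ∧ PhiConvex φ₁ φ₂ f ∧ ∀ x, 0 ≤ f x})
    (hcont : ∀ x y : X, ∀ t ∈ Set.Icc (0 : ℝ) 1, ∀ (fj : ℕ → X → ℝ) (f : X → ℝ),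
      Tendsto (fun j => mu (fj j - f)) atTop (nhds 0) →
      Tendsto (fun j => φ₂ x y t (fj j)) atTop (nhds (φ₂ x y t f))) :
    -- Φ is closed in (M, μ)
    (∀ f : X → ℝ, Continuous f → mu f < ⊤ →
      (∀ ε : ℝ, 0 < ε → ∃ g ∈ Phi, mu (f - g) < ENNReal.ofReal ε) → f ∈ Phi) ∧
    -- (Φ, ρ) is a complete metric space
    (∀ fj : ℕ → X → ℝ, (∀ j, fj j ∈ Phi) →
      (∀ ε : ℝ, 0 < ε → ∃ N : ℕ, ∀ m ≥ N, ∀ n ≥ N, mu (fj m - fj n) < ENNReal.ofReal ε) →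
      ∃ g ∈ Phi, Tendsto (fun j => mu (fj j - g)) atTop (nhds 0)) := by
  have key : ∀ (F : ℕ → X → ℝ) (f : X → ℝ), (∀ j, F j ∈ Phi) →
      Tendsto (fun j => mu (F j - f)) atTop (nhds 0) → f ∈ Phi := by
    subst hPhi
    intro F f hF h
    exact ⟨(tendstoLocallyUniformly_of_mu h).continuous (Frequently.of_forall fun j => (hF j).1),
      mu_lt_top_of_tendsto_mu (fun j => (hF j).2.1) h,
      phiConvex_of_tendsto_mu (fun x y t ht => hcont x y t ht F f h) (fun j => (hF j).2.2.1) h,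
      fun x => ge_of_tendsto' (tendsto_apply_of_mu h x) fun j => (hF j).2.2.2 x⟩
  refine ⟨fun f _ _ hf => ?_, fun fj hfj hcauchy => ?_⟩
  · choose g hg hlt using fun j : ℕ => hf (1 / ((j : ℝ) + 1)) Nat.one_div_pos_of_nat
    refine key g f hg ?_
    have h0 : Tendsto (fun j : ℕ => ENNReal.ofReal (1 / ((j : ℝ) + 1))) atTop (nhds 0) := by
      simpa using ENNReal.tendsto_ofReal (tendsto_one_div_add_atTop_nhds_zero_nat (𝕜 := ℝ))
    exact tendsto_of_tendsto_of_tendsto_of_le_of_le tendsto_const_nhds h0 (fun _ => zero_le)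
      fun j => mu_sub_comm f (g j) ▸ (hlt j).le
  · obtain ⟨g, hg⟩ := exists_tendsto_mu_of_cauchy hcauchy
    exact ⟨g, key fj g hfj hg, hg⟩
end

section
/- ((φ₁,φ₂)-variational principle.) Let X be a real Banach space and φ₁ : X × X × [0,1] → X, φ₂ : X × X × [0,1] × (X → ℝ) → ℝ satisfy (P₁) φ₁(x,x,0) = x; (P₂) φ₁(x,y,λ) + φ₁(z,z,0) = φ₁(x+z,y+z,λ); (P₃) there is C ≥ 1 with φ₂(λx, λx, 0, h) ≤ C((1−λ)h(0) + λh(x)) for all x, λ ∈ [0,1], h ∈ Φ; (P₄) φ₂(x−x₀, y−x₀, λ, h) ≤ φ₂(x, y, λ, h(·−x₀)); and (P₅) the class of (φ₁,φ₂)-convex functions is a convex cone. Let f : X → ℝ ∪ {+∞} be proper, lower semicontinuous and bounded below. Let Y ⊆ F carry a metric ρ_Y of the form ρ_Y(g,h) = μ_Y(g − h), where μ_Y is positively homogeneous (μ_Y(δu) = δ·μ_Y(u) for δ > 0) and satisfies μ_Y(g − h) ≥ μ(g − h) for all g, h ∈ Y, and assume (Y, ρ_Y) is a Baire space. Assume there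 is θ ∈ Y with μ_Y(θ) < ∞, θ(0) = 0, θ(x) ≥ k² whenever k ∈ (0,1) and ‖x‖ ≥ k, such that for every x₀ ∈ X the translate θ(· − x₀) lies in Y with μ_Y(θ(· − x₀)) ≤ μ_Y(θ) + ‖θ‖_{‖x₀‖}, and such that g + δ·θ(· − x₀) ∈ Y for every g ∈ Y, δ ∈ (0,1), x₀ ∈ X, with ρ_Y(g + δθ(·−x₀), g) = δ·μ_Y(θ(·−x₀)). Then the set {g ∈ Y : f + g attains a strong minimum on X} is residual (comeagre) in (Y, ρ_Y). -/
open Filter Set ENNReal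

/-- `h : X → ℝ ∪ {+∞}` attains a strong minimum at `x₀` if `h x₀ = inf h` and every
minimizing sequence for `h` converges in norm to `x₀`. -/
def AttainsStrongMin {X : Type*} [NormedAddCommGroup X] (h : X → EReal) (x₀ : X) : Prop :=
  h x₀ = ⨅ x, h x ∧
  ∀ u : ℕ → X, Tendsto (fun j => h (u j)) atTop (nhds (⨅ x, h x)) →
    Tendsto u atTop (nhds x₀)

/-- `x₀` realises, up to a positive gap, smaller values of `f + g` than all points at distance
at least `k` from it. -/
def HasGapPoint {X : Type*} [NormedAddCommGroup X] (f : X → EReal) (g : X → ℝ) (k : ℝ) : Prop :=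
  ∃ (x₀ : X) (a c : ℝ), a < c ∧ f x₀ ≤ ((a - g x₀ : ℝ) : EReal) ∧
    ∀ x, k ≤ ‖x - x₀‖ → ((c - g x : ℝ) : EReal) ≤ f x

theorem EReal.coe_sub_le_iff_le_add (a b : ℝ) (y : EReal) :
    ((a - b : ℝ) : EReal) ≤ y ↔ (a : EReal) ≤ y + b := by
  induction y with
  | bot => simp [-EReal.coe_sub]
  | top => simp
  | coe y => norm_cast; exact _root_.sub_le_iff_le_add

theorem EReal.le_coe_sub_iff_add_le (a b : ℝ) (y : EReal) :
    y ≤ ((a - b : ℝ) : EReal) ↔ y + b ≤ (a : EReal) := by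
  induction y with
  | bot => simp
  | top => simp [-EReal.coe_sub]
  | coe y => norm_cast; exact _root_.le_sub_iff_add_le

theorem exists_real_inf {X : Type*} {f : X → EReal} {g : X → ℝ} {b : ℝ} (hproper : ∃ x, f x ≠ ⊤)
    (hb : ∀ x, (b : EReal) ≤ f x) (hg : ∀ x, 0 ≤ g x) :
    ∃ m : ℝ, (∀ x, ((m - g x : ℝ) : EReal) ≤ f x) ∧
      ∀ η > 0, ∃ x, f x ≤ ((m + η - g x : ℝ) : EReal) := by
  have hbot : (⨅ x, f x + g x) ≠ ⊥ := by
    refine ne_bot_of_le_ne_bot (EReal.coe_ne_bot b) (le_iInf fun x => ?_)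
    rw [← EReal.coe_sub_le_iff_le_add]
    exact le_trans (EReal.coe_le_coe (by linarith [hg x])) (hb x)
  have htop : (⨅ x, f x + g x) ≠ ⊤ := by
    obtain ⟨x, hx⟩ := hproper
    exact ne_top_of_le_ne_top (EReal.add_ne_top hx (EReal.coe_ne_top _)) (iInf_le _ x)
  have hm := EReal.coe_toReal htop hbot
  set m := (⨅ x, f x + g x).toReal
  refine ⟨m, fun x => ?_, fun η hη => ?_⟩
  · rw [EReal.coe_sub_le_iff_le_add, hm]
    exact iInf_le _ x
  · have : (⨅ x, f x + g x) < ((m + η : ℝ) : EReal) := by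
      rw [← hm]
      exact EReal.coe_lt_coe (by linarith)
    obtain ⟨x, hx⟩ := iInf_lt_iff.1 this
    exact ⟨x, (EReal.le_coe_sub_iff_add_le _ _ _).2 hx.le⟩

section
variable {X : Type*} [NormedAddCommGroup X]

theorem ballSup_le_two_pow_mul_mu (u : X → ℝ) (n : ℕ) :
    ballSup u (n + 1) ≤ 2 ^ (n + 1) * mu u := by
  have h : ballSup u (n + 1) / 2 ^ (n + 1) ≤ mu u :=
    ENNReal.le_tsum (f := fun n : ℕ => ballSup u (n + 1) / 2 ^ (n + 1)) n
  rw [ENNReal.div_le_iff (by positivity) (by finiteness)] at h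
  rwa [mul_comm]

theorem abs_le_of_mu_le {u : X → ℝ} {r : ℝ} (hr : 0 ≤ r) (h : mu u ≤ ENNReal.ofReal r)
    {n : ℕ} {x : X} (hx : ‖x‖ ≤ n + 1) : |u x| ≤ 2 ^ (n + 1) * r := by
  have h1 : (‖u x‖₊ : ℝ≥0∞) ≤ ballSup u (n + 1) :=
    le_iSup₂ (f := fun (x : X) (_ : x ∈ {x : X | ‖x‖ ≤ (n : ℝ) + 1}) => (‖u x‖₊ : ℝ≥0∞)) x hx
  have h2 : (‖u x‖₊ : ℝ≥0∞) ≤ 2 ^ (n + 1) * ENNReal.ofReal r :=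
    (h1.trans (ballSup_le_two_pow_mul_mu u n)).trans (by gcongr)
  have h3 := ENNReal.toReal_mono (by finiteness) h2
  simpa [ENNReal.toReal_ofReal hr] using h3

theorem ballSup_mono (u : X → ℝ) {r s : ℝ} (h : r ≤ s) : ballSup u r ≤ ballSup u s :=
  biSup_mono fun _ hx => le_trans hx h

theorem exists_forall_le_of_coercive {g : X → ℝ}
    (hg : Tendsto g (comap (fun x : X => ‖x‖) atTop) atTop) (M : ℝ) :
    ∃ R : ℝ, ∀ x, R ≤ ‖x‖ → M ≤ g x := by
  have h := tendsto_atTop.1 hg M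
  rw [eventually_comap, eventually_atTop] at h
  obtain ⟨R, hR⟩ := h
  exact ⟨R, fun x hx => hR _ hx x rfl⟩

theorem exists_attainsStrongMin_of_gap [CompleteSpace X] {H : X → EReal}
    (hH : LowerSemicontinuous H)
    (hgap : ∀ k : ℝ, 0 < k → ∃ (x₀ : X) (a c : ℝ), a < c ∧ H x₀ ≤ a ∧
      ∀ x, k ≤ ‖x - x₀‖ → (c : EReal) ≤ H x) :
    ∃ x₀, AttainsStrongMin H x₀ := by
  have hpos (n : ℕ) : (0 : ℝ) < 1 / ((n : ℝ) + 1) := by positivity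
  choose x a c hac hxa hxc using fun n : ℕ => hgap _ (hpos n)
  have hac' (n : ℕ) : (a n : EReal) < c n := EReal.coe_lt_coe (hac n)
  have hsmall {n : ℕ} {y : X} (hy : H y < c n) : ‖y - x n‖ < 1 / ((n : ℝ) + 1) := by
    by_contra! h
    exact (hxc n y h).not_gt hy
  have hcauchy : CauchySeq x := by
    refine cauchySeq_of_le_tendsto_0' (fun n : ℕ => 1 / ((n : ℝ) + 1)) (fun n m hnm => ?_)
      tendsto_one_div_add_atTop_nhds_zero_nat
    have hmn : 1 / ((m : ℝ) + 1) ≤ 1 / ((n : ℝ) + 1) := Nat.one_div_le_one_div hnm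
    rw [dist_eq_norm]
    by_contra! h
    have h1 := (hxc m (x n) (hmn.trans h.le)).trans (hxa n)
    have h2 := (hxc n (x m) (by rw [norm_sub_rev]; exact h.le)).trans (hxa m)
    exact absurd (h1.trans_lt ((hac' n).trans_le h2)) (hac' m).not_gt
  obtain ⟨z, hz⟩ := cauchySeq_tendsto_of_complete hcauchy
  have hmin (y : X) : H z ≤ H y := by
    by_contra! hlt
    have hyz : 0 < ‖y - z‖ := norm_pos_iff.2 (sub_ne_zero.2 fun h => by simp [h] at hlt)
    have h1 : Tendsto (fun n => ‖y - x n‖) atTop (nhds ‖y - z‖) := (hz.const_sub y).norm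
    have h2 : ∀ᶠ n : ℕ in atTop, 1 / ((n : ℝ) + 1) < ‖y - x n‖ :=
      tendsto_one_div_add_atTop_nhds_zero_nat.eventually_lt h1 hyz
    obtain ⟨n, hn1, hn2⟩ := (h2.and (hz.eventually (hH z _ hlt))).exists
    exact absurd ((hxc n y hn1.le).trans_lt (hn2.trans_le (hxa n))) (hac' n).not_gt
  refine ⟨z, le_antisymm (le_iInf hmin) (iInf_le _ _), fun u hu => ?_⟩
  refine Metric.tendsto_nhds.2 fun ε hε => ?_
  have h1 : Tendsto (fun n : ℕ => 1 / ((n : ℝ) + 1) + dist (x n) z) atTop (nhds (0 + 0)) :=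
    tendsto_one_div_add_atTop_nhds_zero_nat.add (tendsto_iff_dist_tendsto_zero.1 hz)
  obtain ⟨n, hn⟩ := (h1.eventually_lt_const (by simpa using hε)).exists
  have h2 : (⨅ y, H y) < c n := ((iInf_le H (x n)).trans (hxa n)).trans_lt (hac' n)
  filter_upwards [hu.eventually_lt_const h2] with j hj
  calc dist (u j) z ≤ dist (u j) (x n) + dist (x n) z := dist_triangle _ _ _
    _ ≤ 1 / ((n : ℝ) + 1) + dist (x n) z := by
      rw [dist_eq_norm (u j)]; gcongr; exact (hsmall hj).le
    _ < ε := hn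

/-- The set of perturbations with a gap point is open for uniform convergence on balls, within a
class of nonnegative functions that are uniformly quasi-monotone along rays from the origin. -/
theorem HasGapPoint.exists_nearby {f : X → EReal} {g : X → ℝ} {k b C : ℝ} [NormedSpace ℝ X]
    (h : HasGapPoint f g k) (hb : ∀ x, (b : EReal) ≤ f x) (hC : 1 ≤ C)
    (hg : Tendsto g (comap (fun x : X => ‖x‖) atTop) atTop) :
    ∃ δ : ℝ, 0 < δ ∧ ∃ n : ℕ, ∀ h : X → ℝ,
      (∀ x, ∀ t ∈ Icc (0 : ℝ) 1, h (t • x) ≤ C * (h 0 + h x)) →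
      (∀ x, ‖x‖ ≤ n + 1 → |g x - h x| ≤ δ) → HasGapPoint f h k := by
  obtain ⟨x₀, a, c, hac, hx₀, hx⟩ := h
  obtain ⟨R, hR⟩ := exists_forall_le_of_coercive hg (C * (c - b + g 0 + 1) + 1)
  obtain ⟨n, hn⟩ := exists_nat_ge (max R ‖x₀‖)
  have hRn : R ≤ n := (le_max_left _ _).trans hn
  have hxn : ‖x₀‖ ≤ n := (le_max_right _ _).trans hn
  refine ⟨min 1 ((c - a) / 4), lt_min one_pos (by linarith), n, fun h hray hclose => ?_⟩
  set δ := min 1 ((c - a) / 4)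
  have hδ1 : δ ≤ 1 := min_le_left _ _
  have hδ2 : δ ≤ (c - a) / 4 := min_le_right _ _
  refine ⟨x₀, a + δ, c - δ, by linarith, hx₀.trans (EReal.coe_le_coe ?_), fun x hkx => ?_⟩
  · linarith [(abs_le.1 (hclose x₀ (by linarith))).1]
  by_cases hxR : ‖x‖ ≤ n + 1
  · refine le_trans (EReal.coe_le_coe ?_) (hx x hkx)
    linarith [(abs_le.1 (hclose x hxR)).2]
  · refine le_trans (EReal.coe_le_coe ?_) (hb x)
    push Not at hxR
    have hn0 : (0 : ℝ) < n + 1 := by positivity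
    have hx0 : 0 < ‖x‖ := hn0.trans hxR
    set t := (n + 1) / ‖x‖ with ht
    have htI : t ∈ Icc (0 : ℝ) 1 := ⟨by positivity, (div_le_one hx0).2 hxR.le⟩
    have hnorm : ‖t • x‖ = n + 1 := by
      rw [norm_smul, Real.norm_of_nonneg htI.1, ht, div_mul_cancel₀ _ hx0.ne']
    have h1 := hray x t htI
    have h2 := hR (t • x) (by linarith)
    have h3 := (abs_le.1 (hclose (t • x) hnorm.le)).2
    have h4 := (abs_le.1 (hclose 0 (by simpa using hn0.le))).1
    have h5 : C * (c - b + g 0 + 1) ≤ C * (h 0 + h x) := by linarith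
    have h6 := le_of_mul_le_mul_left h5 (by linarith)
    have hδ0 : 0 < δ := lt_min one_pos (by linarith)
    linarith

/-- Adding a small multiple of a translated bump creates a gap point, and the translation vector
can be chosen bounded independently of the multiple. -/
theorem exists_hasGapPoint_add_smul {f : X → EReal} {g θ : X → ℝ} {b k : ℝ}
    (hproper : ∃ x, f x ≠ ⊤) (hb : ∀ x, (b : EReal) ≤ f x) (hg : ∀ x, 0 ≤ g x)
    (hgc : Tendsto g (comap (fun x : X => ‖x‖) atTop) atTop) (hk : 0 < k) (hθ0 : θ 0 = 0)
    (hθk : ∀ x, k ≤ ‖x‖ → k ^ 2 ≤ θ x) :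
    ∃ R : ℝ, ∀ δ : ℝ, 0 < δ → ∃ x₀, ‖x₀‖ ≤ R ∧ HasGapPoint f (g + δ • fun x => θ (x - x₀)) k := by
  obtain ⟨m, hm, hm'⟩ := exists_real_inf hproper hb hg
  obtain ⟨R, hR⟩ := exists_forall_le_of_coercive hgc (m + 2 - b)
  refine ⟨R, fun δ hδ => ?_⟩
  have hδk : 0 < δ * k ^ 2 := by positivity
  obtain ⟨x₀, hx₀⟩ := hm' (min 1 (δ * k ^ 2 / 2)) (lt_min one_pos (by linarith))
  have hη1 := min_le_left 1 (δ * k ^ 2 / 2)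
  have hη2 := min_le_right 1 (δ * k ^ 2 / 2)
  refine ⟨x₀, ?_, x₀, m + min 1 (δ * k ^ 2 / 2), m + δ * k ^ 2, by linarith, ?_,
    fun x hx => le_trans (EReal.coe_le_coe ?_) (hm x)⟩
  · by_contra! hlt
    have h1 := EReal.coe_le_coe_iff.1 ((hb x₀).trans hx₀)
    linarith [hR x₀ hlt.le]
  · simpa [hθ0] using hx₀
  · have := mul_le_mul_of_nonneg_left (hθk (x - x₀) hx) hδ.le
    simp only [Pi.add_apply, Pi.smul_apply, smul_eq_mul]
    linarith

end

/-- Theorem 3.1, the `(φ₁, φ₂)`-variational principle: under (P₁)–(P₅), for every proper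
lower semicontinuous bounded below `f : X → ℝ ∪ {+∞}` and every Baire subspace `(Y, ρ_Y)`
of `F` satisfying the hypotheses (i)–(iii), the set
`{g ∈ Y : f + g attains a strong minimum on X}` is residual in `Y`. -/
theorem phi_variational_principle
    {X : Type*} [NormedAddCommGroup X] [NormedSpace ℝ X] [CompleteSpace X]
    (φ₁ : X → X → ℝ → X) (φ₂ : X → X → ℝ → (X → ℝ) → ℝ)
    (Phi Fs : Set (X → ℝ))
    (hPhi : Phi = {f : X → ℝ | Continuous f ∧ mu f < ⊤ ∧ PhiConvex φ₁ φ₂ f ∧ ∀ x, 0 ≤ f x})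
    (hFs : Fs = {f ∈ Phi | Tendsto f (comap (fun x : X => ‖x‖) atTop) atTop})
    -- (P₁)–(P₅)
    (hP1 : ∀ x : X, φ₁ x x 0 = x)
    (hP2 : ∀ x y z : X, ∀ t ∈ Set.Icc (0 : ℝ) 1,
      φ₁ x y t + φ₁ z z 0 = φ₁ (x + z) (y + z) t)
    (hP3 : ∃ C : ℝ, 1 ≤ C ∧ ∀ h ∈ Phi, ∀ x : X, ∀ t ∈ Set.Icc (0 : ℝ) 1,
      φ₂ (t • x) (t • x) 0 h ≤ C * ((1 - t) * h 0 + t * h x))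
    (hP4 : ∀ x₀ x y : X, ∀ t ∈ Set.Icc (0 : ℝ) 1, ∀ h : X → ℝ, PhiConvex φ₁ φ₂ h →
      φ₂ (x - x₀) (y - x₀) t h ≤ φ₂ x y t (fun z => h (z - x₀)))
    (hP5add : ∀ f g : X → ℝ, PhiConvex φ₁ φ₂ f → PhiConvex φ₁ φ₂ g →
      PhiConvex φ₁ φ₂ (f + g))
    (hP5smul : ∀ α : ℝ, 0 < α → ∀ f : X → ℝ, PhiConvex φ₁ φ₂ f →
      PhiConvex φ₁ φ₂ (α • f))
    -- the perturbed function f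
    (f : X → EReal)
    (hbot : ∀ x, f x ≠ ⊥) (hproper : ∃ x, f x ≠ ⊤)
    (hlsc : LowerSemicontinuous f) (hbdd : ∃ b : ℝ, ∀ x, (b : EReal) ≤ f x)
    -- the space (Y, ρ_Y), where ρ_Y (g, h) = μ_Y (g - h)
    (Y : Set (X → ℝ)) (hYF : Y ⊆ Fs)
    (μY : (X → ℝ) → ℝ)
    (hμY_nonneg : ∀ u : X → ℝ, 0 ≤ μY u)
    (hμY_eq_zero : ∀ g ∈ Y, ∀ h ∈ Y, (μY (g - h) = 0 ↔ g = h))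
    (hμY_symm : ∀ u : X → ℝ, μY (-u) = μY u)
    (hμY_tri : ∀ u v : X → ℝ, μY (u + v) ≤ μY u + μY v)
    -- μ_Y is positively homogeneous
    (hμY_hom : ∀ δ : ℝ, 0 < δ → ∀ u : X → ℝ, μY (δ • u) = δ * μY u)
    -- (i) : μ_Y (g - h) ≥ μ (g - h) on Y
    (hμY_ge : ∀ g ∈ Y, ∀ h ∈ Y, mu (g - h) ≤ ENNReal.ofReal (μY (g - h)))
    -- (ii) : (Y, ρ_Y) is a Baire space
    (hBaire : ∀ U : ℕ → Set (X → ℝ),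
      (∀ n : ℕ, ∀ g ∈ U n ∩ Y, ∃ ε : ℝ, 0 < ε ∧ ∀ h ∈ Y, μY (g - h) < ε → h ∈ U n) →
      (∀ n : ℕ, ∀ g ∈ Y, ∀ ε : ℝ, 0 < ε → ∃ h ∈ U n ∩ Y, μY (g - h) < ε) →
      ∀ g ∈ Y, ∀ ε : ℝ, 0 < ε → ∃ h ∈ (⋂ n, U n) ∩ Y, μY (g - h) < ε)
    -- (iii) : the distinguished function θ
    (θ : X → ℝ) (hθY : θ ∈ Y) (hθ0 : θ 0 = 0)
    (hθk : ∀ k : ℝ, 0 < k → k < 1 → ∀ x : X, k ≤ ‖x‖ → k ^ 2 ≤ θ x)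
    (hθtrans : ∀ x₀ : X, (fun x => θ (x - x₀)) ∈ Y ∧
      μY (fun x => θ (x - x₀)) ≤ μY θ + (ballSup θ ‖x₀‖).toReal)
    (hθadd : ∀ g ∈ Y, ∀ δ : ℝ, 0 < δ → δ < 1 → ∀ x₀ : X,
      (g + δ • fun x => θ (x - x₀)) ∈ Y ∧
      μY ((g + δ • fun x => θ (x - x₀)) - g) = δ * μY (fun x => θ (x - x₀))) :
    -- conclusion : {g ∈ Y : f + g attains a strong minimum} is residual in (Y, ρ_Y)
    ∃ U : ℕ → Set (X → ℝ),
      (∀ n : ℕ, U n ⊆ Y) ∧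
      (∀ n : ℕ, ∀ g ∈ U n, ∃ ε : ℝ, 0 < ε ∧ ∀ h ∈ Y, μY (g - h) < ε → h ∈ U n) ∧
      (∀ n : ℕ, ∀ g ∈ Y, ∀ ε : ℝ, 0 < ε → ∃ h ∈ U n, μY (g - h) < ε) ∧
      (∀ g ∈ ⋂ n, U n, ∃ x₀ : X, AttainsStrongMin (fun x => f x + (g x : EReal)) x₀) := by
  obtain ⟨b, hb⟩ := hbdd
  obtain ⟨C, hC, hP3⟩ := hP3
  subst hFs hPhi
  have hk (n : ℕ) : (0 : ℝ) < 1 / ((n : ℝ) + 2) := by positivity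
  have hk1 (n : ℕ) : 1 / ((n : ℝ) + 2) < 1 := by
    rw [div_lt_one (by positivity)]
    linarith [n.cast_nonneg (α := ℝ)]
  refine ⟨fun n => {g ∈ Y | HasGapPoint f g (1 / ((n : ℝ) + 2))}, fun n g hg => hg.1, ?_, ?_, ?_⟩
  · rintro n g ⟨hgY, hgap⟩
    obtain ⟨δ, hδ, N, hN⟩ := hgap.exists_nearby hb hC (hYF hgY).2
    refine ⟨δ / 2 ^ (N + 1), by positivity, fun h hhY hgh => ⟨hhY, hN h ?_ fun x hx => ?_⟩⟩
    · intro x t ht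
      obtain ⟨hhPhi, -⟩ := hYF hhY
      have h1 := hhPhi.2.2.1 (t • x) (t • x) 0 ⟨le_rfl, zero_le_one⟩
      rw [hP1] at h1
      refine (h1.trans (hP3 h hhPhi x t ht)).trans ?_
      have h0 := hhPhi.2.2.2 0
      have hx := hhPhi.2.2.2 x
      gcongr
      · exact mul_le_of_le_one_left h0 (by linarith [ht.1])
      · exact mul_le_of_le_one_left hx ht.2
    · refine (abs_le_of_mu_le (hμY_nonneg _) (hμY_ge g hgY h hhY) hx).trans ?_
      rw [lt_div_iff₀' (by positivity)] at hgh
      exact hgh.le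
  · intro n g hgY ε hε
    obtain ⟨R, hR⟩ := exists_hasGapPoint_add_smul hproper hb (hYF hgY).1.2.2.2 (hYF hgY).2
      (hk n) hθ0 (hθk _ (hk n) (hk1 n))
    obtain ⟨N, hN⟩ := exists_nat_ge R
    set K := μY θ + (ballSup θ (N + 1)).toReal
    have hK : 0 ≤ K := add_nonneg (hμY_nonneg θ) ENNReal.toReal_nonneg
    have hδ : 0 < min (1 / 2) (ε / (K + 1)) := by positivity
    obtain ⟨x₀, hx₀, hgap⟩ := hR _ hδ
    set δ := min (1 / 2) (ε / (K + 1))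
    obtain ⟨hmem, hdist⟩ := hθadd g hgY δ hδ ((min_le_left _ _).trans_lt (by norm_num)) x₀
    refine ⟨_, ⟨hmem, hgap⟩, ?_⟩
    have hfin : ballSup θ (N + 1) ≠ ⊤ :=
      ne_top_of_le_ne_top (ENNReal.mul_ne_top (by finiteness) (hYF hθY).1.2.1.ne)
        (ballSup_le_two_pow_mul_mu θ N)
    have htrans : μY (fun x => θ (x - x₀)) ≤ K := by
      refine (hθtrans x₀).2.trans ?_
      exact add_le_add_right (ENNReal.toReal_mono hfin (ballSup_mono θ (by linarith))) _
    rw [← hμY_symm, neg_sub, hdist]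
    calc δ * μY (fun x => θ (x - x₀)) ≤ δ * K := by gcongr
      _ < δ * (K + 1) := by gcongr; linarith
      _ ≤ ε / (K + 1) * (K + 1) := by gcongr; exact min_le_right _ _
      _ = ε := div_mul_cancel₀ _ (by positivity)
  · intro g hg
    rw [mem_iInter] at hg
    have hgc : Continuous g := (hYF (hg 0).1).1.1
    refine exists_attainsStrongMin_of_gap ?_ fun k hk0 => ?_
    · refine hlsc.add' (continuous_coe_real_ereal.comp hgc).lowerSemicontinuous fun x => ?_
      exact EReal.continuousAt_add (.inr (EReal.coe_ne_bot _)) (.inr (EReal.coe_ne_top _))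
    · obtain ⟨n, hn⟩ := exists_nat_one_div_lt hk0
      obtain ⟨x₀, a, c, hac, hx₀, hx⟩ := (hg n).2
      have hle : 1 / ((n : ℝ) + 2) ≤ 1 / ((n : ℝ) + 1) := by gcongr; norm_num
      exact ⟨x₀, a, c, hac, (EReal.le_coe_sub_iff_add_le _ _ _).1 hx₀,
        fun x hkx => (EReal.coe_sub_le_iff_le_add _ _ _).1 (hx x (hle.trans (hn.le.trans hkx)))⟩
end

section
/- Let X be a real Banach space and h : X → ℝ ∪ {+∞} a proper, lower semicontinuous function bounded below. Suppose that for every positive integer n there exists xₙ ∈ X such that h(xₙ) < inf{h(x) : ‖x − xₙ‖ ≥ 1/n}. Then h attains a strong minimum on X: there exists x₀ ∈ X with h(x₀) = inf_X h such that every sequence (yⱼ) in X with h(yⱼ) → inf_X h converges in norm to x₀. -/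
open Filter Set

/-- If for every `n ≥ 1` there is `xₙ` with `h(xₙ) < inf {h(x) : ‖x - xₙ‖ ≥ 1/n}`, then the
proper lower semicontinuous bounded below function `h` attains a strong minimum on `X`. -/
theorem attainsStrongMin_of_wells
    {X : Type*} [NormedAddCommGroup X] [NormedSpace ℝ X] [CompleteSpace X]
    (h : X → EReal)
    (hbot : ∀ x, h x ≠ ⊥)
    (hproper : ∃ x, h x ≠ ⊤)
    (hlsc : LowerSemicontinuous h)
    (hbdd : ∃ b : ℝ, ∀ x, (b : EReal) ≤ h x)
    (hwells : ∀ n : ℕ, 0 < n → ∃ xn : X,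
      h xn < ⨅ x ∈ {x : X | 1 / (n : ℝ) ≤ ‖x - xn‖}, h x) :
    ∃ x₀ : X, AttainsStrongMin h x₀ := by
  have hne : (comap h (nhds (⨅ x, h x))).NeBot :=
    comap_neBot_iff_frequently.2
      (mem_closure_iff_frequently.1 (isGLB_iInf.mem_closure (range_nonempty h)))
  have hcauchy : Cauchy (comap h (nhds (⨅ x, h x))) := by
    refine Metric.cauchy_iff.2 ⟨hne, fun ε hε => ?_⟩
    obtain ⟨n, hn⟩ := exists_nat_one_div_lt (half_pos hε)
    obtain ⟨z, hz⟩ := hwells (n + 1) n.succ_pos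
    push_cast at hz
    refine ⟨_, preimage_mem_comap (Iio_mem_nhds ((iInf_le h z).trans_lt hz)), ?_⟩
    have key : ∀ x, h x < (⨅ y ∈ {y : X | 1 / ((n : ℝ) + 1) ≤ ‖y - z‖}, h y) →
        dist x z < ε / 2 := fun x hx => by
      by_contra! hc
      rw [dist_eq_norm] at hc
      exact hx.not_ge (iInf₂_le x (hn.le.trans hc))
    intro x hx y hy
    linarith [dist_triangle_right x y z, key x hx, key y hy]
  obtain ⟨x₀, hx₀⟩ := CompleteSpace.complete hcauchy
  refine ⟨x₀, le_antisymm ?_ (iInf_le h x₀), fun u hu => (tendsto_comap_iff.2 hu).mono_right hx₀⟩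
  by_contra! hlt
  obtain ⟨c, hmc, hc⟩ := exists_between hlt
  have hlow : ∀ᶠ x in comap h (nhds (⨅ x, h x)), c < h x := hx₀ (hlsc x₀ c hc)
  have hupp : ∀ᶠ x in comap h (nhds (⨅ x, h x)), h x < c :=
    preimage_mem_comap (Iio_mem_nhds hmc)
  obtain ⟨x, hx, hx'⟩ := (hlow.and hupp).exists
  exact lt_asymm hx hx'
end

section
/- (Deville–Godefroy–Zizler-type variational principle, Corollary 3.4.) Let (X, ‖·‖) be a real Banach space and suppose there exist C ≥ 1 and a Lipschitz function d : X → ℝ which is C¹-smooth on X ∖ {0}, satisfies d(λx) = λd(x) for all λ > 0 and x ∈ X, satisfies ‖x‖ ≤ d(x) ≤ C‖x‖ for all x ∈ X, and such that d² is C¹-smooth on all of X (such a d exists whenever X admits a Lipschitz C¹-smooth bump function). Define φ₁(x,y,λ) = λx + (1−λ)y and φ₂(x,y,λ,g) = C²(λg(x) + (1−λ)g(y)). Let f : X → ℝ ∪ {+∞} be proper, lower semicontinuous and bounded below, and let Y = {g : X → ℝ : g is (φ₁,φ₂)-convex, continuously Fréchet differentiable with g′ bounded on bounded sets, g ≥ 0,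 g(x) → +∞ as ‖x‖ → +∞, and Σ_{n≥1} ‖g‖ₙ/2ⁿ + Σ_{n≥1} ‖g′‖ₙ/2ⁿ < ∞}, equipped with the metric ρ_Y(g,h) = Σ_{n≥1} ‖g − h‖ₙ/2ⁿ + Σ_{n≥1} ‖(g − h)′‖ₙ/2ⁿ, where ‖g′‖ₙ = sup_{‖x‖≤n} ‖g′(x)‖_{X*}. Then the set {g ∈ Y : f + g attains a strong minimum on X} is residual (comeagre) in (Y, ρ_Y). -/
open Filter Set ENNReal

/-- `‖g'‖_r = sup {‖g'(x)‖_{X*} : ‖x‖ ≤ r}`, valued in `ℝ≥0∞`. -/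
noncomputable def derivBallSup {X : Type*} [NormedAddCommGroup X] [NormedSpace ℝ X]
    (g : X → ℝ) (r : ℝ) : ℝ≥0∞ :=
  ⨆ x ∈ {x : X | ‖x‖ ≤ r}, (‖fderiv ℝ g x‖₊ : ℝ≥0∞)

/-- The norm `μ_Y (g) = Σ_{n ≥ 1} ‖g‖ₙ/2ⁿ + Σ_{n ≥ 1} ‖g'‖ₙ/2ⁿ`, valued in `ℝ≥0∞`. -/
noncomputable def muDGZ {X : Type*} [NormedAddCommGroup X] [NormedSpace ℝ X]
    (g : X → ℝ) : ℝ≥0∞ :=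
  mu g + ∑' n : ℕ, derivBallSup g (n + 1) / 2 ^ (n + 1)

theorem EReal.coe_le_add_coe_of_le {F : EReal} {c c' p q : ℝ} (h : (c : EReal) ≤ F + (p : EReal))
    (hc : c' ≤ c - p + q) : (c' : EReal) ≤ F + (q : EReal) := by
  induction F with
  | bot => simp at h
  | top => simp
  | coe r =>
    norm_cast at h ⊢
    linarith

theorem EReal.add_coe_le_coe_of_le {F : EReal} {a a' p q : ℝ} (h : F + (p : EReal) ≤ (a : EReal))
    (ha : a - p + q ≤ a') : F + (q : EReal) ≤ (a' : EReal) := by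
  induction F with
  | bot => simp
  | top => simp at h
  | coe r =>
    norm_cast at h ⊢
    linarith

theorem ballSup_le {X : Type*} [NormedAddCommGroup X] {k : X → ℝ} {r B : ℝ}
    (h : ∀ x, ‖x‖ ≤ r → |k x| ≤ B) :
    ballSup k r ≤ ENNReal.ofReal B := by
  refine iSup₂_le fun x hx => ?_
  rw [← enorm_eq_nnnorm, ← ofReal_norm]
  exact ENNReal.ofReal_le_ofReal (h x hx)

theorem exists_forall_le_of_tendsto_comap_norm {X : Type*} [NormedAddCommGroup X]
    {g : X → ℝ}
    (hg : Tendsto g (comap (fun x : X => ‖x‖) atTop) atTop) (M : ℝ) :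
    ∃ R : ℝ, ∀ x, R ≤ ‖x‖ → M ≤ g x := by
  have h := hg.eventually (eventually_ge_atTop M)
  rw [eventually_comap] at h
  obtain ⟨R, hR⟩ := eventually_atTop.1 h
  exact ⟨R, fun x hx => hR _ hx x rfl⟩

theorem summable_succ_sq_div_two_pow :
    Summable fun n : ℕ => ((n : ℝ) + 1) ^ 2 / 2 ^ (n + 1) := by
  have h := summable_pow_mul_geometric_of_norm_lt_one 2 (r := (1 / 2 : ℝ)) (by norm_num)
  refine ((summable_nat_add_iff 1).2 h).congr fun n => ?_
  push_cast
  rw [one_div, inv_pow, div_eq_mul_inv]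

section WeightedSums

variable {X : Type*} [NormedAddCommGroup X] [NormedSpace ℝ X]

theorem abs_lt_of_muDGZ_lt {k : X → ℝ} {N : ℕ} {δ : ℝ}
    (hk : muDGZ k < ENNReal.ofReal (δ / 2 ^ (N + 1))) {x : X} (hx : ‖x‖ ≤ N + 1) :
    |k x| < δ := by
  have h1 : (‖k x‖₊ : ℝ≥0∞) ≤ ballSup k (N + 1) :=
    le_iSup₂_of_le (f := fun x (_ : x ∈ {x : X | ‖x‖ ≤ (N : ℝ) + 1}) => (‖k x‖₊ : ℝ≥0∞))
      x hx le_rfl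
  have h2 : ballSup k (N + 1) / 2 ^ (N + 1) ≤ muDGZ k :=
    (ENNReal.le_tsum (f := fun n : ℕ => ballSup k (n + 1) / 2 ^ (n + 1)) N).trans le_self_add
  have h3 : (‖k x‖₊ : ℝ≥0∞) / 2 ^ (N + 1) < ENNReal.ofReal (δ / 2 ^ (N + 1)) :=
    ((ENNReal.div_le_div_right h1 _).trans h2).trans_lt hk
  have h4 : (‖k x‖₊ : ℝ≥0∞) / 2 ^ (N + 1) = ENNReal.ofReal (|k x| / 2 ^ (N + 1)) := by
    rw [ENNReal.ofReal_div_of_pos (by positivity), ENNReal.ofReal_pow (by norm_num),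
      ← Real.norm_eq_abs, ofReal_norm]
    simp [enorm]
  rw [h4, ENNReal.ofReal_lt_ofReal_iff_of_nonneg (by positivity)] at h3
  exact (div_lt_div_iff_of_pos_right (by positivity)).1 h3

theorem derivBallSup_le {k : X → ℝ} {r B : ℝ} (h : ∀ x, ‖x‖ ≤ r → ‖fderiv ℝ k x‖ ≤ B) :
    derivBallSup k r ≤ ENNReal.ofReal B := by
  refine iSup₂_le fun x hx => ?_
  rw [← enorm_eq_nnnorm, ← ofReal_norm]
  exact ENNReal.ofReal_le_ofReal (h x hx)

/-- A function with quadratic growth, whose derivative also has quadratic growth, has `muDGZ`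
bounded by a multiple of the growth constant. -/
theorem muDGZ_le_of_quadratic_growth {k : X → ℝ} {B : ℝ} (hB : 0 ≤ B)
    (h : ∀ (n : ℕ) (x : X), ‖x‖ ≤ n + 1 → |k x| ≤ B * (n + 1) ^ 2)
    (h' : ∀ (n : ℕ) (x : X), ‖x‖ ≤ n + 1 → ‖fderiv ℝ k x‖ ≤ B * (n + 1) ^ 2) :
    muDGZ k ≤ ENNReal.ofReal (2 * B * ∑' n : ℕ, ((n : ℝ) + 1) ^ 2 / 2 ^ (n + 1)) := by
  have key : ∀ s : ℕ → ℝ≥0∞, (∀ n : ℕ, s n ≤ ENNReal.ofReal (B * (n + 1) ^ 2)) →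
      ∑' n : ℕ, s n / 2 ^ (n + 1) ≤
        ENNReal.ofReal (B * ∑' n : ℕ, ((n : ℝ) + 1) ^ 2 / 2 ^ (n + 1)) := by
    intro s hs
    rw [← tsum_mul_left, ENNReal.ofReal_tsum_of_nonneg (fun n => by positivity)
      (summable_succ_sq_div_two_pow.mul_left B)]
    refine ENNReal.tsum_le_tsum fun n => ?_
    refine (ENNReal.div_le_div_right (hs n) _).trans_eq ?_
    rw [← mul_div_assoc, ENNReal.ofReal_div_of_pos (by positivity),
      ENNReal.ofReal_pow (by norm_num)]
    simp
  have hS : 0 ≤ ∑' n : ℕ, ((n : ℝ) + 1) ^ 2 / 2 ^ (n + 1) := tsum_nonneg fun n => by positivity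
  rw [mul_assoc, two_mul, ENNReal.ofReal_add (by positivity) (by positivity)]
  exact add_le_add (key _ fun n => ballSup_le (h n)) (key _ fun n => derivBallSup_le (h' n))

theorem muDGZ_neg (k : X → ℝ) : muDGZ (-k) = muDGZ k := by
  simp [muDGZ, mu, ballSup, derivBallSup, fderiv_neg]

theorem muDGZ_add_le {g k : X → ℝ} (hg : Differentiable ℝ g) (hk : Differentiable ℝ k) :
    muDGZ (g + k) ≤ muDGZ g + muDGZ k := by
  have h1 : ∀ r, ballSup (g + k) r ≤ ballSup g r + ballSup k r := fun r =>
    iSup₂_le fun x hx => (ENNReal.coe_le_coe.2 (nnnorm_add_le (g x) (k x))).trans <| by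
      rw [ENNReal.coe_add]
      exact add_le_add (le_iSup₂ (f := fun x (_ : x ∈ {x : X | ‖x‖ ≤ r}) => (‖g x‖₊ : ℝ≥0∞)) x hx)
        (le_iSup₂ (f := fun x (_ : x ∈ {x : X | ‖x‖ ≤ r}) => (‖k x‖₊ : ℝ≥0∞)) x hx)
  have h2 : ∀ r, derivBallSup (g + k) r ≤ derivBallSup g r + derivBallSup k r := fun r =>
    iSup₂_le fun x hx => by
      rw [fderiv_add (hg x) (hk x)]
      refine (ENNReal.coe_le_coe.2 (nnnorm_add_le (fderiv ℝ g x) (fderiv ℝ k x))).trans ?_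
      rw [ENNReal.coe_add]
      exact add_le_add
        (le_iSup₂ (f := fun x (_ : x ∈ {x : X | ‖x‖ ≤ r}) => (‖fderiv ℝ g x‖₊ : ℝ≥0∞)) x hx)
        (le_iSup₂ (f := fun x (_ : x ∈ {x : X | ‖x‖ ≤ r}) => (‖fderiv ℝ k x‖₊ : ℝ≥0∞)) x hx)
  have key : ∀ s t u : ℕ → ℝ≥0∞, (∀ n, s n ≤ t n + u n) →
      ∑' n : ℕ, s n / 2 ^ (n + 1) ≤ ∑' n : ℕ, t n / 2 ^ (n + 1) + ∑' n : ℕ, u n / 2 ^ (n + 1) := by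
    intro s t u h
    rw [← ENNReal.tsum_add]
    refine ENNReal.tsum_le_tsum fun n => ?_
    rw [← ENNReal.add_div]
    exact ENNReal.div_le_div_right (h n) _
  refine (add_le_add (key _ _ _ fun n => h1 _) (key _ _ _ fun n => h2 _)).trans_eq ?_
  rw [muDGZ, muDGZ, mu, mu]
  ring

/-- An approximately convex function that is large on a sphere is large outside of it. -/
theorem le_of_le_on_sphere {h : X → ℝ} {K R m : ℝ} (hK : 0 < K) (hR : 0 < R) (hm : 0 ≤ m)
    (hconv : ∀ x y : X, ∀ t ∈ Icc (0 : ℝ) 1,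
      h (t • x + (1 - t) • y) ≤ K * (t * h x + (1 - t) * h y))
    (h0 : 0 ≤ h 0) (hsphere : ∀ x : X, ‖x‖ = R → K * (h 0 + m) ≤ h x)
    {x : X} (hx : R ≤ ‖x‖) : m ≤ h x := by
  have hxp : 0 < ‖x‖ := hR.trans_le hx
  have ht0 : 0 < R / ‖x‖ := by positivity
  have ht1 : R / ‖x‖ ≤ 1 := (div_le_one hxp).2 hx
  have h1 := hconv x 0 (R / ‖x‖) ⟨ht0.le, ht1⟩
  have h2 := hsphere ((R / ‖x‖) • x) (by
    rw [norm_smul, Real.norm_of_nonneg ht0.le, div_mul_cancel₀ _ hxp.ne'])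
  rw [smul_zero, add_zero] at h1
  have h3 := le_of_mul_le_mul_left (h2.trans h1) hK
  set t := R / ‖x‖
  have h4 : t * m ≤ t * h x := by nlinarith
  exact le_of_mul_le_mul_left h4 ht0

end WeightedSums

section SquaredGauge

variable {X : Type*} [NormedAddCommGroup X] [NormedSpace ℝ X] {C : ℝ} {d : X → ℝ}

theorem sq_comp_sub_approx_convex (hC : 1 ≤ C) (hd_lower : ∀ x : X, ‖x‖ ≤ d x)
    (hd_upper : ∀ x : X, d x ≤ C * ‖x‖) (x₀ x y : X) {t : ℝ} (ht : t ∈ Icc (0 : ℝ) 1) :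
    d (t • x + (1 - t) • y - x₀) ^ 2 ≤ C ^ 2 * (t * d (x - x₀) ^ 2 + (1 - t) * d (y - x₀) ^ 2) := by
  obtain ⟨ht0, ht1⟩ := ht
  have hs : 0 ≤ 1 - t := by linarith
  have e : t • x + (1 - t) • y - x₀ = t • (x - x₀) + (1 - t) • (y - x₀) := by
    module
  have h1 : ‖t • x + (1 - t) • y - x₀‖ ≤ t * ‖x - x₀‖ + (1 - t) * ‖y - x₀‖ := by
    rw [e]
    refine (norm_add_le _ _).trans_eq ?_
    rw [norm_smul, norm_smul, Real.norm_of_nonneg ht0, Real.norm_of_nonneg hs]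
  have h2 : t * ‖x - x₀‖ + (1 - t) * ‖y - x₀‖ ≤ t * d (x - x₀) + (1 - t) * d (y - x₀) := by
    gcongr <;> exact hd_lower _
  have h3 : d (t • x + (1 - t) • y - x₀) ≤ C * (t * d (x - x₀) + (1 - t) * d (y - x₀)) :=
    (hd_upper _).trans (mul_le_mul_of_nonneg_left (h1.trans h2) (by linarith))
  have h4 : 0 ≤ d (t • x + (1 - t) • y - x₀) := (norm_nonneg _).trans (hd_lower _)
  refine (pow_le_pow_left₀ h4 h3 2).trans ?_
  rw [mul_pow]
  refine mul_le_mul_of_nonneg_left ?_ (by positivity)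
  nlinarith [mul_nonneg (mul_nonneg ht0 hs) (sq_nonneg (d (x - x₀) - d (y - x₀)))]

theorem norm_fderiv_sq_comp_sub_le {K : NNReal} (hC : 1 ≤ C) (hd_lip : LipschitzWith K d)
    (hd_lower : ∀ x : X, ‖x‖ ≤ d x) (hd_upper : ∀ x : X, d x ≤ C * ‖x‖) (x₀ x : X) :
    ‖fderiv ℝ (fun x => d (x - x₀) ^ 2) x‖ ≤ K * (2 * C * (‖x‖ + ‖x₀‖ + 1)) := by
  refine norm_fderiv_le_of_lip' ℝ (by positivity) ?_
  filter_upwards [Metric.ball_mem_nhds x one_pos] with y hy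
  have hy' : ‖y‖ ≤ ‖x‖ + 1 := by
    have := norm_sub_norm_le y x
    have := mem_ball_iff_norm.1 hy
    linarith
  have hbd : ∀ z : X, ‖z‖ ≤ ‖x‖ + 1 → d (z - x₀) ≤ C * (‖x‖ + ‖x₀‖ + 1) := fun z hz =>
    (hd_upper _).trans (mul_le_mul_of_nonneg_left
      ((norm_sub_le _ _).trans (by linarith)) (by linarith))
  have hpos : ∀ z : X, 0 ≤ d z := fun z => (norm_nonneg _).trans (hd_lower z)
  have hl : |d (y - x₀) - d (x - x₀)| ≤ K * ‖y - x‖ := by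
    have := hd_lip.dist_le_mul (y - x₀) (x - x₀)
    rwa [Real.dist_eq, dist_sub_right, dist_eq_norm] at this
  have hsum : |d (y - x₀) + d (x - x₀)| ≤ 2 * C * (‖x‖ + ‖x₀‖ + 1) := by
    rw [abs_of_nonneg (add_nonneg (hpos _) (hpos _))]
    linarith [hbd y hy', hbd x (by linarith)]
  calc ‖d (y - x₀) ^ 2 - d (x - x₀) ^ 2‖
      = |d (y - x₀) + d (x - x₀)| * |d (y - x₀) - d (x - x₀)| := by
        rw [sq_sub_sq, Real.norm_eq_abs, abs_mul]
    _ ≤ (2 * C * (‖x‖ + ‖x₀‖ + 1)) * (K * ‖y - x‖) := by gcongr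
    _ = K * (2 * C * (‖x‖ + ‖x₀‖ + 1)) * ‖y - x‖ := by ring

/-- The perturbations `x ↦ d (x - x₀) ^ 2` and their derivatives have quadratic growth, uniformly
for `x₀` in a bounded set. -/
theorem exists_quadratic_growth_sq_comp_sub {K : NNReal} (hC : 1 ≤ C) (hd_lip : LipschitzWith K d)
    (hd_lower : ∀ x : X, ‖x‖ ≤ d x) (hd_upper : ∀ x : X, d x ≤ C * ‖x‖) {R : ℝ} (hR : 0 ≤ R) :
    ∃ B : ℝ, 0 ≤ B ∧ ∀ x₀ : X, ‖x₀‖ ≤ R → ∀ (n : ℕ) (x : X), ‖x‖ ≤ n + 1 →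
      d (x - x₀) ^ 2 ≤ B * (n + 1) ^ 2 ∧
      ‖fderiv ℝ (fun x => d (x - x₀) ^ 2) x‖ ≤ B * (n + 1) ^ 2 := by
  have hC0 : 0 ≤ C := by linarith
  refine ⟨(C * (1 + R)) ^ 2 + K * (2 * C * (2 + R)), by positivity, fun x₀ hx₀ n x hx => ?_⟩
  have hn : (1 : ℝ) ≤ n + 1 := by simp
  have hsq : (n + 1 : ℝ) ≤ (n + 1) ^ 2 := by nlinarith
  have hb : 0 ≤ K * (2 * C * (2 + R)) := by positivity
  constructor
  · have h1 : d (x - x₀) ≤ C * ((1 + R) * (n + 1)) :=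
      (hd_upper _).trans (mul_le_mul_of_nonneg_left
        ((norm_sub_le _ _).trans (by nlinarith)) hC0)
    calc d (x - x₀) ^ 2 ≤ (C * ((1 + R) * (n + 1))) ^ 2 :=
          pow_le_pow_left₀ ((norm_nonneg _).trans (hd_lower _)) h1 2
      _ = (C * (1 + R)) ^ 2 * (n + 1) ^ 2 := by ring
      _ ≤ _ := by gcongr; linarith
  · calc _ ≤ K * (2 * C * (‖x‖ + ‖x₀‖ + 1)) :=
          norm_fderiv_sq_comp_sub_le hC hd_lip hd_lower hd_upper x₀ x
      _ ≤ K * (2 * C * ((2 + R) * (n + 1) ^ 2)) := by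
          gcongr
          nlinarith
      _ = K * (2 * C * (2 + R)) * (n + 1) ^ 2 := by ring
      _ ≤ _ := by gcongr; linarith [sq_nonneg (C * (1 + R))]

end SquaredGauge

/-- `x₀` is a `(1 / (n + 1))`-strict approximate minimizer of `h`: the values of `h` outside the
ball of radius `1 / (n + 1)` around `x₀` stay away from `h x₀`. -/
def IsLocalizedMin {X : Type*} [NormedAddCommGroup X] (h : X → EReal) (n : ℕ) (x₀ : X) : Prop :=
  ∃ a c : ℝ, a < c ∧ h x₀ ≤ a ∧ ∀ x, 1 / ((n : ℝ) + 1) ≤ ‖x - x₀‖ → (c : EReal) ≤ h x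

theorem attainsStrongMin_of_isLocalizedMin {X : Type*} [NormedAddCommGroup X] [CompleteSpace X]
    {h : X → EReal} (hlsc : LowerSemicontinuous h) (hloc : ∀ n, ∃ x₀, IsLocalizedMin h n x₀) :
    ∃ x₀, AttainsStrongMin h x₀ := by
  choose x a c hac hxa hxc using hloc
  have hsep : ∀ n y, h y < c n → ‖y - x n‖ < 1 / ((n : ℝ) + 1) := fun n y hy => by
    by_contra! hc
    exact (hxc n y hc).not_gt hy
  have hx : ∀ n, h (x n) < c n := fun n => (hxa n).trans_lt (EReal.coe_lt_coe (hac n))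
  have hdist : ∀ n m, n ≤ m → dist (x n) (x m) < 1 / ((n : ℝ) + 1) := by
    intro n m hnm
    rcases lt_or_ge (h (x m)) (c n) with hlt | hge
    · rw [dist_comm, dist_eq_norm]
      exact hsep n _ hlt
    · rw [dist_eq_norm]
      exact (hsep m _ (((hx n).trans_le hge).trans (hx m))).trans_le (Nat.one_div_le_one_div hnm)
  have hcauchy : CauchySeq x :=
    cauchySeq_of_le_tendsto_0' (fun n : ℕ => 1 / ((n : ℝ) + 1)) (fun n m hnm => (hdist n m hnm).le)
      tendsto_one_div_add_atTop_nhds_zero_nat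
  obtain ⟨z, hz⟩ := cauchySeq_tendsto_of_complete hcauchy
  have hmin : ∀ u : ℕ → X, Tendsto (fun j => h (u j)) atTop (nhds (⨅ x, h x)) →
      Tendsto u atTop (nhds z) := by
    intro u hu
    rw [Metric.tendsto_atTop']
    intro ε hε
    obtain ⟨n, hn1, hn2⟩ := ((hz.eventually (Metric.ball_mem_nhds z (half_pos hε))).and
      (tendsto_one_div_add_atTop_nhds_zero_nat.eventually (gt_mem_nhds (half_pos hε)))).exists
    obtain ⟨N, hN⟩ := eventually_atTop.1 (hu.eventually
      (gt_mem_nhds ((iInf_le h _).trans_lt (hx n))))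
    refine ⟨N, fun j hj => ?_⟩
    have h1 : dist (u j) (x n) < 1 / ((n : ℝ) + 1) := by
      rw [dist_eq_norm]
      exact hsep n _ (hN j hj.le)
    have h2 : dist (x n) z < ε / 2 := hn1
    linarith [dist_triangle (u j) (x n) z]
  refine ⟨z, le_antisymm ?_ (iInf_le h z), hmin⟩
  have : Nonempty X := ⟨z⟩
  obtain ⟨v, -, hv, hvm⟩ := exists_seq_tendsto_sInf (Set.range_nonempty h) (OrderBot.bddBelow _)
  choose u hu using hvm
  have hu' : Tendsto (fun j => h (u j)) atTop (nhds (⨅ x, h x)) := by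
    simp only [hu]
    exact hv
  refine le_of_forall_lt fun y hy => ?_
  obtain ⟨w, hyw, hwz⟩ := exists_between hy
  exact hyw.trans_le (ge_of_tendsto hu'
    (((hmin u hu').eventually (hlsc z w hwz)).mono fun j hj => hj.le))

section Openness

variable {X : Type*} [NormedAddCommGroup X] [NormedSpace ℝ X]

theorem exists_isLocalizedMin_of_muDGZ_sub_lt {f : X → EReal} {b K : ℝ} (hK : 0 < K)
    (hb : ∀ x, (b : EReal) ≤ f x) {g : X → ℝ}
    (hg : Tendsto g (comap (fun x : X => ‖x‖) atTop) atTop) {n : ℕ} {x₀ : X}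
    (hmin : IsLocalizedMin (fun x => f x + (g x : EReal)) n x₀) :
    ∃ ε : ℝ, 0 < ε ∧ ∀ h : X → ℝ, (∀ x, 0 ≤ h x) →
      (∀ x y : X, ∀ t ∈ Icc (0 : ℝ) 1,
        h (t • x + (1 - t) • y) ≤ K * (t * h x + (1 - t) * h y)) →
      muDGZ (g - h) < ENNReal.ofReal ε →
      IsLocalizedMin (fun x => f x + (h x : EReal)) n x₀ := by
  obtain ⟨a, c, hac, ha, hc⟩ := hmin
  obtain ⟨R, hR⟩ := exists_forall_le_of_tendsto_comap_norm hg (K * (g 0 + 1 + |c - b|) + 1)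
  obtain ⟨N, hN⟩ := exists_nat_ge (max R ‖x₀‖)
  have hRN : R ≤ N + 1 := by linarith [le_max_left R ‖x₀‖]
  have hxN : ‖x₀‖ ≤ N + 1 := by linarith [le_max_right R ‖x₀‖]
  have hNpos : (0 : ℝ) < N + 1 := by positivity
  have hδ : 0 < min 1 ((c - a) / 3) := lt_min one_pos (by linarith)
  refine ⟨min 1 ((c - a) / 3) / 2 ^ (N + 1), by positivity, fun h h0 hconv hgh => ?_⟩
  have hclose : ∀ x : X, ‖x‖ ≤ N + 1 → |g x - h x| < min 1 ((c - a) / 3) := fun x hx =>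
    abs_lt_of_muDGZ_lt hgh hx
  have hclose1 : ∀ x : X, ‖x‖ ≤ N + 1 → |g x - h x| < 1 := fun x hx =>
    (hclose x hx).trans_le (min_le_left _ _)
  have hclose2 : ∀ x : X, ‖x‖ ≤ N + 1 → |g x - h x| < (c - a) / 3 := fun x hx =>
    (hclose x hx).trans_le (min_le_right _ _)
  refine ⟨a + (c - a) / 3, c - (c - a) / 3, by linarith, ?_, fun x hx => ?_⟩
  · exact EReal.add_coe_le_coe_of_le ha (by linarith [(abs_lt.1 (hclose2 x₀ hxN)).1])
  · rcases le_total ‖x‖ (N + 1) with hxn | hxn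
    · exact EReal.coe_le_add_coe_of_le (hc x hx) (by linarith [(abs_lt.1 (hclose2 x hxn)).2])
    · have hlarge : |c - b| ≤ h x := by
        refine le_of_le_on_sphere hK hNpos (abs_nonneg _) hconv (h0 0) (fun y hy => ?_) hxn
        have h1 := hR y (by rw [hy]; exact hRN)
        have h2 := (abs_lt.1 (hclose1 y hy.le)).2
        have h3 := (abs_lt.1 (hclose1 0 (by simpa using hNpos.le))).1
        have h4 : K * (h 0 + |c - b|) ≤ K * (g 0 + 1 + |c - b|) := by
          gcongr
          linarith
        linarith
      refine EReal.coe_le_add_coe_of_le (c := b) (p := 0) (by simpa using hb x) ?_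
      linarith [le_abs_self (c - b)]

end Openness

theorem isLocalizedMin_add_of_le {X : Type*} [NormedAddCommGroup X] {f : X → EReal}
    {g k : X → ℝ} {m η : ℝ} {n : ℕ} {x₀ : X} (hη : 0 < η)
    (hm : ∀ x, (m : EReal) ≤ f x + (g x : EReal))
    (hx₀ : f x₀ + (g x₀ : EReal) ≤ ((m + η / ((n : ℝ) + 1) ^ 2 / 2 : ℝ) : EReal))
    (hk0 : k x₀ = 0) (hk : ∀ x, η * ‖x - x₀‖ ^ 2 ≤ k x) :
    IsLocalizedMin (fun x => f x + ((g + k) x : EReal)) n x₀ := by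
  have hpos : 0 < η / ((n : ℝ) + 1) ^ 2 := by positivity
  refine ⟨m + η / ((n : ℝ) + 1) ^ 2 / 2, m + η / ((n : ℝ) + 1) ^ 2, by linarith, ?_,
    fun x hx => ?_⟩
  · simpa [hk0] using hx₀
  · refine EReal.coe_le_add_coe_of_le (hm x) ?_
    have h1 : η / ((n : ℝ) + 1) ^ 2 ≤ η * ‖x - x₀‖ ^ 2 := by
      rw [div_eq_mul_one_div, ← one_div_pow]
      gcongr
    have h2 := hk x
    simp only [Pi.add_apply]
    linarith

theorem exists_coe_eq_iInf_add {X : Type*} {f : X → EReal} {b : ℝ}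
    (hb : ∀ x, (b : EReal) ≤ f x) (hproper : ∃ x, f x ≠ ⊤) {g : X → ℝ} (hg : ∀ x, 0 ≤ g x) :
    ∃ m : ℝ, (m : EReal) = ⨅ x, f x + (g x : EReal) := by
  obtain ⟨x, hx⟩ := hproper
  have h1 : (b : EReal) ≤ ⨅ x, f x + (g x : EReal) := le_iInf fun y =>
    EReal.coe_le_add_coe_of_le (c := b) (p := 0) (by simpa using hb y) (by linarith [hg y])
  have h2 : (⨅ x, f x + (g x : EReal)) < ⊤ :=
    (iInf_le _ x).trans_lt (EReal.add_lt_top hx (EReal.coe_ne_top _))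
  exact ⟨_, EReal.coe_toReal h2.ne ((EReal.bot_lt_coe b).trans_le h1).ne'⟩

/-- Deville–Godefroy–Zizler-type variational principle (Corollary 3.4): in a Banach space
admitting a Leduc-type Lipschitz `C¹`-smooth positively homogeneous function `d` with
`‖x‖ ≤ d(x) ≤ C‖x‖` and `d²` of class `C¹`, for every proper lower semicontinuous bounded
below `f : X → ℝ ∪ {+∞}` the set `{g ∈ Y : f + g attains a strong minimum on X}` is
residual in `(Y, ρ_Y)`. -/
theorem dgz_variational_principle
    {X : Type*} [NormedAddCommGroup X] [NormedSpace ℝ X] [CompleteSpace X]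
    (C : ℝ) (hC : 1 ≤ C) (d : X → ℝ)
    (hd_lip : ∃ K : NNReal, LipschitzWith K d)
    (hd_smooth : ContDiffOn ℝ 1 d {(0 : X)}ᶜ)
    (hd_hom : ∀ t : ℝ, 0 < t → ∀ x : X, d (t • x) = t * d x)
    (hd_lower : ∀ x : X, ‖x‖ ≤ d x) (hd_upper : ∀ x : X, d x ≤ C * ‖x‖)
    (hd_sq : ContDiff ℝ 1 (fun x : X => (d x) ^ 2))
    (φ₁ : X → X → ℝ → X) (φ₂ : X → X → ℝ → (X → ℝ) → ℝ)
    (hφ₁ : φ₁ = fun x y t => t • x + (1 - t) • y)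
    (hφ₂ : φ₂ = fun x y t g => C ^ 2 * (t * g x + (1 - t) * g y))
    (f : X → EReal)
    (hbot : ∀ x, f x ≠ ⊥) (hproper : ∃ x, f x ≠ ⊤)
    (hlsc : LowerSemicontinuous f) (hbdd : ∃ b : ℝ, ∀ x, (b : EReal) ≤ f x)
    (Y : Set (X → ℝ))
    (hY : Y = {g : X → ℝ | PhiConvex φ₁ φ₂ g ∧ ContDiff ℝ 1 g ∧
      (∀ r : ℝ, ∃ K : ℝ, ∀ x : X, ‖x‖ ≤ r → ‖fderiv ℝ g x‖ ≤ K) ∧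
      (∀ x, 0 ≤ g x) ∧ Tendsto g (comap (fun x : X => ‖x‖) atTop) atTop ∧ muDGZ g < ⊤}) :
    ∃ U : ℕ → Set (X → ℝ),
      (∀ n : ℕ, U n ⊆ Y) ∧
      -- each U n is open in (Y, ρ_Y)
      (∀ n : ℕ, ∀ g ∈ U n, ∃ ε : ℝ, 0 < ε ∧
        ∀ h ∈ Y, muDGZ (g - h) < ENNReal.ofReal ε → h ∈ U n) ∧
      -- each U n is dense in (Y, ρ_Y)
      (∀ n : ℕ, ∀ g ∈ Y, ∀ ε : ℝ, 0 < ε → ∃ h ∈ U n, muDGZ (g - h) < ENNReal.ofReal ε) ∧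
      -- every element of the intersection gives a strong minimum
      (∀ g ∈ ⋂ n, U n, ∃ x₀ : X, AttainsStrongMin (fun x => f x + (g x : EReal)) x₀) := by
  subst hφ₁ hφ₂
  obtain ⟨b, hb⟩ := hbdd
  obtain ⟨K, hK⟩ := hd_lip
  have hC0 : 0 < C := by linarith
  refine ⟨fun n => {g ∈ Y | ∃ x₀, IsLocalizedMin (fun x => f x + (g x : EReal)) n x₀},
    fun n => sep_subset _ _, ?_, ?_, ?_⟩
  · rintro n g ⟨hgY, x₀, hx₀⟩
    subst hY
    obtain ⟨ε, hε, h⟩ := exists_isLocalizedMin_of_muDGZ_sub_lt (K := C ^ 2) (by positivity) hb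
      hgY.2.2.2.2.1 hx₀
    exact ⟨ε, hε, fun k hk hgk => ⟨hk, x₀, h k hk.2.2.2.1 hk.1 hgk⟩⟩
  · intro n g hgY ε hε
    subst hY
    obtain ⟨hgconv, hgC1, hgbd, hg0, hgtend, hgmu⟩ := hgY
    obtain ⟨m, hm⟩ := exists_coe_eq_iInf_add hb hproper hg0
    obtain ⟨R, hR⟩ := exists_forall_le_of_tendsto_comap_norm hgtend (m + 1 - b)
    obtain ⟨B, hB0, hB⟩ := exists_quadratic_growth_sq_comp_sub hC hK hd_lower hd_upper
      (le_max_right R 0)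
    set S := ∑' n : ℕ, ((n : ℝ) + 1) ^ 2 / 2 ^ (n + 1)
    have hS : 0 ≤ S := tsum_nonneg fun n => by positivity
    obtain ⟨η, hη, hηε⟩ : ∃ η : ℝ, 0 < η ∧ 2 * (η * B) * S < ε := by
      refine ⟨ε / (2 * B * S + 1), by positivity, ?_⟩
      rw [show 2 * (ε / (2 * B * S + 1) * B) * S = ε * (2 * B * S) / (2 * B * S + 1) by ring,
        div_lt_iff₀ (by positivity)]
      nlinarith
    have hη' : 0 < min 1 (η / ((n : ℝ) + 1) ^ 2 / 2) := lt_min one_pos (by positivity)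
    obtain ⟨x₀, hx₀⟩ : ∃ x₀, f x₀ + (g x₀ : EReal) <
        ((m + min 1 (η / ((n : ℝ) + 1) ^ 2 / 2) : ℝ) : EReal) := by
      rw [← iInf_lt_iff, ← hm, EReal.coe_lt_coe_iff]
      linarith
    have hx₀R : ‖x₀‖ ≤ max R 0 := by
      by_contra! hc
      have h1 := hR x₀ ((le_max_left _ _).trans hc.le)
      have h2 : ((m + 1 : ℝ) : EReal) ≤ f x₀ + (g x₀ : EReal) :=
        EReal.coe_le_add_coe_of_le (c := b) (p := 0) (by simpa using hb x₀) (by linarith)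
      refine (h2.trans_lt hx₀).not_ge (EReal.coe_le_coe ?_)
      linarith [min_le_left 1 (η / ((n : ℝ) + 1) ^ 2 / 2)]
    have hd0 : d 0 = 0 := le_antisymm (by simpa using hd_upper 0) (by simpa using hd_lower 0)
    have hqC1 : ContDiff ℝ 1 (fun x => d (x - x₀) ^ 2) :=
      hd_sq.comp (contDiff_id.sub contDiff_const)
    have hqd : Differentiable ℝ (fun x => d (x - x₀) ^ 2) := hqC1.differentiable one_ne_zero
    set k : X → ℝ := fun x => η * d (x - x₀) ^ 2 with hk
    have hkC1 : ContDiff ℝ 1 k := contDiff_const.mul hqC1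
    have hkd : Differentiable ℝ k := hkC1.differentiable one_ne_zero
    have hk0 : ∀ x, 0 ≤ k x := fun x => by positivity
    have hkB : ∀ (n : ℕ) (x : X), ‖x‖ ≤ n + 1 → |k x| ≤ η * B * (n + 1) ^ 2 := fun n x hx => by
      rw [abs_of_nonneg (hk0 x), mul_assoc]
      exact mul_le_mul_of_nonneg_left (hB x₀ hx₀R n x hx).1 hη.le
    have hkB' : ∀ (n : ℕ) (x : X), ‖x‖ ≤ n + 1 → ‖fderiv ℝ k x‖ ≤ η * B * (n + 1) ^ 2 :=
      fun n x hx => by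
      rw [hk, fderiv_const_mul (hqd x), norm_smul, Real.norm_of_nonneg hη.le, mul_assoc]
      exact mul_le_mul_of_nonneg_left (hB x₀ hx₀R n x hx).2 hη.le
    have hkmu : muDGZ k ≤ ENNReal.ofReal (2 * (η * B) * S) :=
      muDGZ_le_of_quadratic_growth (by positivity) hkB hkB'
    refine ⟨g + k, ⟨⟨?_, hgC1.add hkC1, ?_, fun x => add_nonneg (hg0 x) (hk0 x), ?_, ?_⟩,
      x₀, ?_⟩, ?_⟩
    · intro x y t ht
      have h1 := hgconv x y t ht
      have h2 := mul_le_mul_of_nonneg_left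
        (sq_comp_sub_approx_convex hC hd_lower hd_upper x₀ x y ht) hη.le
      simp only [Pi.add_apply, hk] at h1 h2 ⊢
      linarith
    · intro r
      obtain ⟨A, hA⟩ := hgbd r
      obtain ⟨N, hN⟩ := exists_nat_ge r
      refine ⟨A + η * B * (N + 1) ^ 2, fun x hx => ?_⟩
      rw [fderiv_add (hgC1.differentiable one_ne_zero x) (hkd x)]
      exact (norm_add_le _ _).trans (add_le_add (hA x hx) (hkB' N x (by linarith)))
    · exact tendsto_atTop_mono (fun x => le_add_of_nonneg_right (hk0 x)) hgtend
    · exact (muDGZ_add_le (hgC1.differentiable one_ne_zero) hkd).trans_lt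
        (ENNReal.add_lt_top.2 ⟨hgmu, hkmu.trans_lt ENNReal.ofReal_lt_top⟩)
    · refine isLocalizedMin_add_of_le hη (fun x => hm.trans_le (iInf_le _ x)) ?_ ?_ ?_
      · exact hx₀.le.trans (EReal.coe_le_coe (by gcongr; exact min_le_right _ _))
      · simp [hk, hd0]
      · intro x
        have := hd_lower (x - x₀)
        simp only [hk]
        gcongr
    · rw [show g - (g + k) = -k by abel, muDGZ_neg]
      exact hkmu.trans_lt ((ENNReal.ofReal_lt_ofReal_iff hε).2 hηε)
  · intro g hg
    simp only [mem_iInter] at hg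
    have hgY := (hg 0).1
    subst hY
    have hgc : Continuous g := hgY.2.1.continuous
    refine attainsStrongMin_of_isLocalizedMin ?_ fun n => (hg n).2
    refine hlsc.add' (continuous_coe_real_ereal.comp hgc).lowerSemicontinuous fun x => ?_
    exact EReal.continuousAt_add (Or.inr (EReal.coe_ne_bot _)) (Or.inr (EReal.coe_ne_top _))
end
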